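/- Every GM-sequence reaches and then never leaves the 'periodic regime': for every position x⁰ there exists an integer N ≥ 0 such that for all j ≥ 0, the conjunction (m(x^j) ≥ n−k and range(x^j) ≤ ℓ) holds if and only if j ≥ N, where x^{j+1} = G(x^j) is the GM-sequence from x⁰. -/

import Mathlib

namespace Screw

/-- The set of indices whose entries are multiples of `ℓ`. -/
def mulSet {n : ℕ} (ℓ : ℕ) (x : Fin n → ℤ) : Finset (Fin n) :=
  Finset.univ.filter (fun i => (ℓ : ℤ) ∣ x i)

/-- `m(x)`: the number of entries of `x` that are multiples of `ℓ`. -/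
def mcount {n : ℕ} (ℓ : ℕ) (x : Fin n → ℤ) : ℕ := (mulSet ℓ x).card

/-- The tie-breaking order: `i` precedes `j` iff `x i < x j`, or `x i = x j` and `i ≥ j`
(the rightmost index is preferred). -/
def tieLE {n : ℕ} (x : Fin n → ℤ) (i j : Fin n) : Bool :=
  decide (x i < x j ∨ (x i = x j ∧ j ≤ i))

/-- The bear set `P(x)`: if `m(x) ≥ n - k`, the `n - k` smallest (w.r.t. the tie-breaking
order) indices whose entries are multiples of `ℓ`; otherwise all of `M(x)` together with
the `n - k - m(x)` largest indices not in `M(x)`. -/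
noncomputable def bearSet {n : ℕ} (k ℓ : ℕ) (x : Fin n → ℤ) : Finset (Fin n) :=
  let M := mulSet ℓ x
  if n - k ≤ M.card then
    ((M.toList.mergeSort (tieLE x)).take (n - k)).toFinset
  else
    M ∪ (((Finset.univ \ M).toList.mergeSort (fun i j => decide (j ≤ i))).take
          (n - k - M.card)).toFinset

/-- The GM-move: bearish entries are kept, all other (bullish) entries are reduced by 1. -/
noncomputable def gmMove {n : ℕ} (k ℓ : ℕ) (x : Fin n → ℤ) : Fin n → ℤ :=
  fun i => if i ∈ bearSet k ℓ x then x i else x i - 1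

/-- `range(x) = x_n - x_1` (for a monotone `x`). -/
def rangeOf {n : ℕ} (x : Fin n → ℤ) : ℤ :=
  if h : 0 < n then x ⟨n - 1, by omega⟩ - x ⟨0, h⟩ else 0

/-- A cyclic interval of `{1,…,n}` (here `Fin n`): the empty set, the full set,
an ordinary interval `{a,…,b}` (`a ≤ b`), or a wrap-around interval
`{a,…,n} ∪ {1,…,b}` (`b < a`). -/
def IsCyclicInterval {n : ℕ} (I : Finset (Fin n)) : Prop :=
  I = ∅ ∨ I = Finset.univ ∨
    ∃ a b : Fin n, (a ≤ b ∧ I = Finset.Icc a b) ∨ (b < a ∧ I = Finset.Ici a ∪ Finset.Iic b)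

end Screw

namespace Screw

theorem take_facts {n : ℕ} (M : Finset (Fin n)) (r : Fin n → Fin n → Bool)
    (htr : ∀ a b c, r a b = true → r b c = true → r a c = true)
    (hto : ∀ a b, (r a b || r b a) = true) (c : ℕ) :
    ((M.toList.mergeSort r).take c).toFinset ⊆ M ∧
    ((M.toList.mergeSort r).take c).toFinset.card = min c M.card ∧
    ∀ i ∈ ((M.toList.mergeSort r).take c).toFinset, ∀ j ∈ M,
      j ∉ ((M.toList.mergeSort r).take c).toFinset → r i j = true := by
  have hp : (M.toList.mergeSort r).Perm M.toList := List.mergeSort_perm _ _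
  have hs := List.pairwise_mergeSort htr hto M.toList
  have hnd : (M.toList.mergeSort r).Nodup := hp.nodup_iff.2 M.nodup_toList
  have hmem : ∀ a, a ∈ M.toList.mergeSort r ↔ a ∈ M := fun a => by
    rw [hp.mem_iff, Finset.mem_toList]
  have hlen : (M.toList.mergeSort r).length = M.card := by
    rw [hp.length_eq, Finset.length_toList]
  generalize M.toList.mergeSort r = L at *
  refine ⟨?_, ?_, ?_⟩
  · intro a ha
    rw [List.mem_toFinset] at ha
    exact (hmem a).1 (List.mem_of_mem_take ha)
  · rw [List.toFinset_card_of_nodup (hnd.sublist (List.take_sublist c L)), List.length_take, hlen]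
  · intro i hi j hj hj'
    rw [List.mem_toFinset] at hi hj'
    rw [← hmem, ← List.take_append_drop c L, List.mem_append] at hj
    have hj2 := hj.resolve_left hj'
    rw [← List.take_append_drop c L, List.pairwise_append] at hs
    exact hs.2.2 i hi j hj2

theorem bear_big {n k ℓ : ℕ} {x : Fin n → ℤ} (h : n - k ≤ mcount ℓ x) :
    bearSet k ℓ x ⊆ mulSet ℓ x ∧ (bearSet k ℓ x).card = n - k ∧
    ∀ i ∈ bearSet k ℓ x, ∀ j ∈ mulSet ℓ x, j ∉ bearSet k ℓ x →
      (x i < x j ∨ (x i = x j ∧ j ≤ i)) := by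
  have := take_facts (mulSet ℓ x) (tieLE x) (by
    intro a b c; simp only [tieLE, decide_eq_true_eq]; omega) (by
    intro a b; simp only [tieLE, Bool.or_eq_true, decide_eq_true_eq]; omega) (n - k)
  have e : bearSet k ℓ x = (((mulSet ℓ x).toList.mergeSort (tieLE x)).take (n - k)).toFinset := by
    unfold bearSet; exact if_pos h
  rw [← e] at this
  obtain ⟨h1, h2, h3⟩ := this
  refine ⟨h1, ?_, ?_⟩
  · rw [h2]; exact min_eq_left h
  · intro i hi j hj hj'
    have := h3 i hi j hj hj'
    simpa [tieLE] using this

theorem bear_small {n k ℓ : ℕ} {x : Fin n → ℤ} (h : ¬ n - k ≤ mcount ℓ x) :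
    mulSet ℓ x ⊆ bearSet k ℓ x ∧ (bearSet k ℓ x).card ≤ n - k ∧
    ∀ i ∈ bearSet k ℓ x, i ∉ mulSet ℓ x → ∀ j, j ∉ bearSet k ℓ x → j ≤ i := by
  have := take_facts (Finset.univ \ mulSet ℓ x) (fun i j => decide (j ≤ i)) (by
    intro a b c; simp only [decide_eq_true_eq]; omega) (by
    intro a b; simp only [Bool.or_eq_true, decide_eq_true_eq]; omega) (n - k - (mulSet ℓ x).card)
  have e : bearSet k ℓ x = mulSet ℓ x ∪ (((Finset.univ \ mulSet ℓ x).toList.mergeSort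
      (fun i j => decide (j ≤ i))).take (n - k - (mulSet ℓ x).card)).toFinset := by
    unfold bearSet; exact if_neg h
  obtain ⟨h1, h2, h3⟩ := this
  generalize (((Finset.univ \ mulSet ℓ x).toList.mergeSort
      (fun i j => decide (j ≤ i))).take (n - k - (mulSet ℓ x).card)).toFinset = T at *
  unfold mcount at h
  rw [e]
  refine ⟨Finset.subset_union_left, ?_, ?_⟩
  · have := Finset.card_union_le (mulSet ℓ x) T
    omega
  · intro i hi hi' j hj
    simp only [Finset.mem_union, not_or] at hi hj
    have := h3 i (hi.resolve_left hi') j (by simp [hj.1]) hj.2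
    simpa using this

theorem mem_mul {n ℓ : ℕ} {x : Fin n → ℤ} {i : Fin n} : i ∈ mulSet ℓ x ↔ (ℓ : ℤ) ∣ x i := by
  simp [mulSet]

theorem exists_bull {n k ℓ : ℕ} (hk : 0 < k) (hkn : k < n) (x : Fin n → ℤ) :
    ∃ i, i ∉ bearSet k ℓ x := by
  by_contra! hc
  have h1 : bearSet k ℓ x = Finset.univ := Finset.eq_univ_iff_forall.2 hc
  have h2 : (bearSet k ℓ x).card ≤ n - k := by
    by_cases h : n - k ≤ mcount ℓ x
    · exact (bear_big h).2.1.le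
    · exact (bear_small h).2.1
  rw [h1, Finset.card_univ, Fintype.card_fin] at h2
  omega

theorem move_bear {n k ℓ : ℕ} {x : Fin n → ℤ} {i : Fin n} (h : i ∈ bearSet k ℓ x) :
    gmMove k ℓ x i = x i := by simp [gmMove, h]

theorem move_bull {n k ℓ : ℕ} {x : Fin n → ℤ} {i : Fin n} (h : i ∉ bearSet k ℓ x) :
    gmMove k ℓ x i = x i - 1 := by simp [gmMove, h]

theorem move_le {n k ℓ : ℕ} (x : Fin n → ℤ) (i : Fin n) : gmMove k ℓ x i ≤ x i := by
  unfold gmMove; split_ifs <;> omega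

theorem move_ge {n k ℓ : ℕ} (x : Fin n → ℤ) (i : Fin n) : x i - 1 ≤ gmMove k ℓ x i := by
  unfold gmMove; split_ifs <;> omega

theorem move_mono {n k ℓ : ℕ} {x : Fin n → ℤ} (hx : Monotone x) : Monotone (gmMove k ℓ x) := by
  intro i j hij
  rcases hij.eq_or_lt with rfl | hlt
  · exact le_rfl
  have hxx := hx hij
  by_cases hi : i ∈ bearSet k ℓ x
  · rw [move_bear hi]
    by_cases hj : j ∈ bearSet k ℓ x
    · rw [move_bear hj]; exact hxx
    · rw [move_bull hj]
      rcases hxx.eq_or_lt with he | hl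
      · exfalso
        by_cases h : n - k ≤ mcount ℓ x
        · obtain ⟨h1, -, h3⟩ := bear_big h
          have hiM := h1 hi
          have hjM : j ∈ mulSet ℓ x := by rw [mem_mul, ← he, ← mem_mul]; exact hiM
          have := h3 i hi j hjM hj
          omega
        · obtain ⟨h1, -, h3⟩ := bear_small h
          have hjM : j ∉ mulSet ℓ x := fun hh => hj (h1 hh)
          have hiM : i ∉ mulSet ℓ x := by rw [mem_mul, he, ← mem_mul]; exact hjM
          have := h3 i hi hiM j hj
          omega
      · omega
  · rw [move_bull hi]
    have := move_ge (k := k) (ℓ := ℓ) x j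
    omega

theorem big_step {n k ℓ : ℕ} {x : Fin n → ℤ} (h : n - k ≤ mcount ℓ x) :
    n - k ≤ mcount ℓ (gmMove k ℓ x) := by
  obtain ⟨h1, h2, -⟩ := bear_big h
  rw [← h2]
  apply Finset.card_le_card
  intro i hi
  rw [mem_mul, move_bear hi, ← mem_mul]
  exact h1 hi

theorem reach {α β : Type*} [Preorder β] [WellFoundedLT β] (f : α → α) (Inv Tgt : α → Prop)
    (μ : α → β)
    (h : ∀ x, Inv x → Tgt x ∨ Tgt (f x) ∨ (Inv (f x) ∧ μ (f x) < μ x)) :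
    ∀ x, Inv x → ∃ j : ℕ, Tgt (f^[j] x) := by
  have key : ∀ b : β, ∀ x, μ x = b → Inv x → ∃ j : ℕ, Tgt (f^[j] x) := by
    intro b
    induction b using WellFoundedLT.induction with
    | ind b ih =>
      intro x hb hx
      rcases h x hx with h1 | h1 | ⟨h1, h2⟩
      · exact ⟨0, h1⟩
      · exact ⟨1, h1⟩
      · obtain ⟨j, hj⟩ := ih (μ (f x)) (hb ▸ h2) (f x) rfl h1
        exact ⟨j + 1, by rwa [Function.iterate_succ_apply]⟩
  exact fun x => key _ x rfl

theorem emod_pred {a l : ℤ} (hl : 1 < l) (h : ¬ l ∣ a) : (a - 1) % l = a % l - 1 := by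
  have h1 : a % l ≠ 0 := fun hh => h (Int.dvd_of_emod_eq_zero hh)
  have h2 := Int.emod_nonneg a (by omega : l ≠ 0)
  have h3 := Int.emod_lt_of_pos a (by omega : 0 < l)
  have h4 : a - 1 = (a % l - 1) + l * (a / l) := by
    have := Int.emod_add_mul_ediv a l
    omega
  rw [h4, Int.add_mul_emod_self_left]
  exact Int.emod_eq_of_lt (by omega) (by omega)

theorem phaseA {n k ℓ : ℕ} (hk : 0 < k) (hkn : k < n) (hℓ : 1 < ℓ) (x : Fin n → ℤ)
    (hx : Monotone x) :
    ∃ j : ℕ, Monotone ((gmMove k ℓ)^[j] x) ∧ n - k ≤ mcount ℓ ((gmMove k ℓ)^[j] x) := by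
  refine reach (gmMove k ℓ) Monotone (fun x => Monotone x ∧ n - k ≤ mcount ℓ x)
    (fun x => (∑ i, x i % (ℓ : ℤ)).toNat) ?_ x hx
  intro x hx
  by_cases h : n - k ≤ mcount ℓ x
  · exact Or.inl ⟨hx, h⟩
  refine Or.inr (Or.inr ⟨move_mono hx, ?_⟩)
  obtain ⟨h1, -, -⟩ := bear_small h
  have hl : (1 : ℤ) < ℓ := by exact_mod_cast hℓ
  have hbull : ∀ i, i ∉ bearSet k ℓ x → gmMove k ℓ x i % (ℓ : ℤ) = x i % (ℓ : ℤ) - 1 := by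
    intro i hi
    rw [move_bull hi]
    exact emod_pred hl (fun hd => hi (h1 (mem_mul.2 hd)))
  have hlt : ∑ i, gmMove k ℓ x i % (ℓ : ℤ) < ∑ i, x i % (ℓ : ℤ) := by
    obtain ⟨i, hi⟩ := exists_bull (ℓ := ℓ) hk hkn x
    refine Finset.sum_lt_sum ?_ ⟨i, Finset.mem_univ _, by rw [hbull i hi]; omega⟩
    intro i _
    by_cases hi : i ∈ bearSet k ℓ x
    · rw [move_bear hi]
    · rw [hbull i hi]; omega
  have hnn : 0 ≤ ∑ i, gmMove k ℓ x i % (ℓ : ℤ) :=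
    Finset.sum_nonneg fun i _ => Int.emod_nonneg _ (by omega)
  show (∑ i, gmMove k ℓ x i % (ℓ : ℤ)).toNat < (∑ i, x i % (ℓ : ℤ)).toNat
  omega

/-- the invariant of the last phase -/
def J {n : ℕ} (k ℓ : ℕ) (z : Fin n) (x : Fin n → ℤ) : Prop :=
  ∃ q : ℤ, n - k ≤ ((mulSet ℓ x).filter (fun i => x i ≤ ℓ * q)).card ∧ ℓ * (q - 1) ≤ x z

theorem big_of_filter {n k ℓ : ℕ} {x : Fin n → ℤ} {c : ℤ}
    (h : n - k ≤ ((mulSet ℓ x).filter (fun i => x i ≤ c)).card) : n - k ≤ mcount ℓ x :=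
  h.trans (Finset.card_le_card (Finset.filter_subset _ _))

theorem bears_le {n k ℓ : ℕ} {x : Fin n → ℤ} {c : ℤ}
    (h : n - k ≤ ((mulSet ℓ x).filter (fun i => x i ≤ c)).card) :
    ∀ i ∈ bearSet k ℓ x, x i ≤ c := by
  obtain ⟨h1, h2, h3⟩ := bear_big (big_of_filter h)
  intro i hi
  by_contra! hc
  have hsub : insert i ((mulSet ℓ x).filter (fun i => x i ≤ c)) ⊆ bearSet k ℓ x := by
    intro j hj
    rcases Finset.mem_insert.1 hj with rfl | hj
    · exact hi
    · by_contra hjb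
      have := Finset.mem_filter.1 hj
      have := h3 i hi j this.1 hjb
      omega
  have := Finset.card_le_card hsub
  rw [Finset.card_insert_of_notMem (by simp; intro _; omega)] at this
  omega

theorem filter_step {n k ℓ : ℕ} {x : Fin n → ℤ} {c : ℤ} (hm : n - k ≤ mcount ℓ x)
    (h : ∀ i ∈ bearSet k ℓ x, x i ≤ c) :
    n - k ≤ ((mulSet ℓ (gmMove k ℓ x)).filter (fun i => gmMove k ℓ x i ≤ c)).card := by
  obtain ⟨h1, h2, h3⟩ := bear_big hm
  rw [← h2]
  apply Finset.card_le_card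
  intro i hi
  rw [Finset.mem_filter, mem_mul, move_bear hi, ← mem_mul]
  exact ⟨h1 hi, h i hi⟩

/-- leaving a multiple -/
theorem leave {n k ℓ : ℕ} {x : Fin n → ℤ} {z : Fin n} {c : ℤ} (hm : n - k ≤ mcount ℓ x)
    (hc : ℓ * c ≤ x z) (hc' : gmMove k ℓ x z < ℓ * c) (hℓ : 1 < ℓ) :
    J k ℓ z (gmMove k ℓ x) := by
  obtain ⟨h1, h2, h3⟩ := bear_big hm
  have hg := move_ge (k := k) (ℓ := ℓ) x z
  have hz : z ∉ bearSet k ℓ x := fun h => by rw [move_bear h] at hc'; omega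
  have he : x z = ℓ * c := by omega
  have hzM : z ∈ mulSet ℓ x := mem_mul.2 ⟨c, he⟩
  refine ⟨c, filter_step hm ?_, ?_⟩
  · intro i hi
    have := h3 i hi z hzM hz
    omega
  · have : (ℓ : ℤ) * (c - 1) = ℓ * c - ℓ := by ring
    omega

theorem phaseB {n k ℓ : ℕ} (hk : 0 < k) (hkn : k < n) (hℓ : 1 < ℓ) (z : Fin n)
    (hz : ∀ i, z ≤ i) (x : Fin n → ℤ)
    (hx : Monotone x) (hm : n - k ≤ mcount ℓ x) :
    ∃ j : ℕ, Monotone ((gmMove k ℓ)^[j] x) ∧ J k ℓ z ((gmMove k ℓ)^[j] x) := by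
  have hl0 : (0 : ℤ) < ℓ := by exact_mod_cast (by omega : 0 < ℓ)
  refine reach (gmMove k ℓ)
    (fun y => Monotone y ∧ n - k ≤ mcount ℓ y ∧ ℓ * (x z / ℓ) ≤ y z)
    (fun y => Monotone y ∧ J k ℓ z y)
    (fun y => (∑ i, (y i - ℓ * (x z / ℓ))).toNat) ?_ x ⟨hx, hm, Int.mul_ediv_self_le hl0.ne'⟩
  generalize x z / (ℓ : ℤ) = c
  rintro y ⟨hy, hm, hc⟩
  by_cases h : ℓ * c ≤ gmMove k ℓ y z
  · refine Or.inr (Or.inr ⟨⟨move_mono hy, big_step hm, h⟩, ?_⟩)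
    have hlt : ∑ i, (gmMove k ℓ y i - ℓ * c) < ∑ i, (y i - ℓ * c) := by
      obtain ⟨i, hi⟩ := exists_bull (ℓ := ℓ) hk hkn y
      refine Finset.sum_lt_sum ?_ ⟨i, Finset.mem_univ _, by rw [move_bull hi]; omega⟩
      intro i _
      have := move_le (k := k) (ℓ := ℓ) y i
      omega
    have hnn : 0 ≤ ∑ i, (gmMove k ℓ y i - ℓ * c) := by
      refine Finset.sum_nonneg fun i _ => ?_
      have := move_mono (k := k) (ℓ := ℓ) hy (hz i)
      omega
    show (∑ i, (gmMove k ℓ y i - ℓ * c)).toNat < (∑ i, (y i - ℓ * c)).toNat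
    omega
  · exact Or.inr (Or.inl ⟨move_mono hy, leave hm hc (by omega) hℓ⟩)

theorem J_step {n k ℓ : ℕ} {x : Fin n → ℤ} {z : Fin n} (hℓ : 1 < ℓ) (h : J k ℓ z x) :
    J k ℓ z (gmMove k ℓ x) := by
  obtain ⟨q, h1, h2⟩ := h
  by_cases hh : ℓ * (q - 1) ≤ gmMove k ℓ x z
  · exact ⟨q, filter_step (big_of_filter h1) (bears_le h1), hh⟩
  · exact leave (big_of_filter h1) h2 (by omega) hℓ

theorem phaseC {n k ℓ : ℕ} (hkn : k < n) (hℓ : 1 < ℓ) (z w : Fin n)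
    (hz : ∀ i, z ≤ i) (x : Fin n → ℤ)
    (hx : Monotone x) (hJ : J k ℓ z x) :
    ∃ j : ℕ, n - k ≤ mcount ℓ ((gmMove k ℓ)^[j] x) ∧
      (gmMove k ℓ)^[j] x w - (gmMove k ℓ)^[j] x z ≤ ℓ := by
  have hl : (1 : ℤ) < ℓ := by exact_mod_cast hℓ
  refine reach (gmMove k ℓ)
    (fun y => Monotone y ∧ J k ℓ z y)
    (fun y => n - k ≤ mcount ℓ y ∧ y w - y z ≤ ℓ)
    (fun y => (toLex ((y w - y z).toNat, toLex ((Finset.univ.filter (fun i => y i = y z)).card,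
      (y z % (ℓ : ℤ)).toNat)) : ℕ ×ₗ ℕ ×ₗ ℕ)) ?_ x ⟨hx, hJ⟩
  rintro y ⟨hy, hJ⟩
  have hJ' := hJ
  obtain ⟨q, h1, h2⟩ := hJ'
  have hm := big_of_filter h1
  by_cases hr : y w - y z ≤ ℓ
  · exact Or.inl ⟨hm, hr⟩
  refine Or.inr (Or.inr ⟨⟨move_mono hy, J_step hℓ hJ⟩, ?_⟩)
  have hring : (ℓ : ℤ) * (q - 1) = ℓ * q - ℓ := by ring
  have hw : w ∉ bearSet k ℓ y := fun hh => by
    have := bears_le h1 w hh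
    omega
  have hw' := move_bull hw
  rw [Prod.Lex.toLex_lt_toLex]
  by_cases hzb : z ∈ bearSet k ℓ y
  · left
    have := move_bear hzb
    show (gmMove k ℓ y w - gmMove k ℓ y z).toNat < (y w - y z).toNat
    omega
  · right
    have hz' := move_bull hzb
    refine ⟨?_, ?_⟩
    · show (gmMove k ℓ y w - gmMove k ℓ y z).toNat = (y w - y z).toNat
      omega
    have hsub : (Finset.univ.filter (fun i => gmMove k ℓ y i = gmMove k ℓ y z)) ⊆
        (Finset.univ.filter (fun i => y i = y z)) := by
      intro i hi
      simp only [Finset.mem_filter, Finset.mem_univ, true_and] at hi ⊢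
      have := hy (hz i)
      have := move_ge (k := k) (ℓ := ℓ) y i
      omega
    show toLex ((Finset.univ.filter (fun i => gmMove k ℓ y i = gmMove k ℓ y z)).card,
      (gmMove k ℓ y z % (ℓ : ℤ)).toNat) < toLex ((Finset.univ.filter (fun i => y i = y z)).card,
      (y z % (ℓ : ℤ)).toNat)
    rw [Prod.Lex.toLex_lt_toLex]
    by_cases hd : (ℓ : ℤ) ∣ y z
    · left
      dsimp only
      apply Finset.card_lt_card
      refine ⟨hsub, fun hcon => ?_⟩
      obtain ⟨-, h4, h5⟩ := bear_big hm
      obtain ⟨i, hi⟩ : (bearSet k ℓ y).Nonempty := Finset.card_pos.1 (by omega)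
      have h6 := h5 i hi z (mem_mul.2 hd) hzb
      have h7 := hy (hz i)
      have h8 : i ∈ Finset.univ.filter (fun i => y i = y z) := by simp; omega
      have h9 := hcon h8
      simp only [Finset.mem_filter, Finset.mem_univ, true_and] at h9
      rw [move_bear hi] at h9
      omega
    · have hle := Finset.card_le_card hsub
      have he := emod_pred hl hd
      have hnn := Int.emod_nonneg (y z - 1) (by omega : (ℓ : ℤ) ≠ 0)
      rw [← hz'] at he hnn
      rcases hle.lt_or_eq with hlt | heq
      · exact Or.inl hlt
      · refine Or.inr ⟨heq, ?_⟩
        show (gmMove k ℓ y z % (ℓ : ℤ)).toNat < (y z % (ℓ : ℤ)).toNat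
        omega

theorem regime_step {n k ℓ : ℕ} (hℓ : 1 < ℓ) (z w : Fin n) {x : Fin n → ℤ}
    (hm : n - k ≤ mcount ℓ x) (hr : x w - x z ≤ ℓ) :
    gmMove k ℓ x w - gmMove k ℓ x z ≤ ℓ := by
  by_contra! hc
  obtain ⟨h1, h2, h3⟩ := bear_big hm
  have a1 := move_ge (k := k) (ℓ := ℓ) x z
  have a2 := move_le (k := k) (ℓ := ℓ) x w
  have hz : z ∉ bearSet k ℓ x := fun h => by rw [move_bear h] at hc; omega
  have hw : w ∈ bearSet k ℓ x := by
    by_contra h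
    rw [move_bull h] at hc; omega
  have he : x z = x w - ℓ := by omega
  have hzM : z ∈ mulSet ℓ x := by
    rw [mem_mul, he]
    exact dvd_sub (mem_mul.1 (h1 hw)) dvd_rfl
  have := h3 w hw z hzM hz
  omega

end Screw

open Screw in
/-- Every GM-sequence reaches, and then never leaves, the periodic
regime: there is `N` such that `m(x^j) ≥ n - k` and `range(x^j) ≤ ℓ` hold iff `j ≥ N`. -/
theorem exists_threshold (n k ℓ : ℕ) (hk : 0 < k) (hkn : k < n) (hℓ : 1 < ℓ)
    (x₀ : Fin n → ℤ) (hx : Monotone x₀) :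
    ∃ N : ℕ, ∀ j : ℕ,
      (n - k ≤ mcount ℓ ((gmMove k ℓ)^[j] x₀) ∧
        rangeOf ((gmMove k ℓ)^[j] x₀) ≤ (ℓ : ℤ)) ↔ N ≤ j := by
  have hn : 0 < n := by omega
  have hrange : ∀ y : Fin n → ℤ, rangeOf y = y ⟨n - 1, by omega⟩ - y ⟨0, hn⟩ := fun y => by
    unfold rangeOf; exact dif_pos hn
  simp only [hrange]
  have hz : ∀ i : Fin n, (⟨0, hn⟩ : Fin n) ≤ i := fun i => Fin.mk_le_of_le_val (Nat.zero_le _)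
  generalize (⟨n - 1, by omega⟩ : Fin n) = w
  generalize (⟨0, hn⟩ : Fin n) = z at *
  have hex : ∃ j : ℕ, n - k ≤ mcount ℓ ((gmMove k ℓ)^[j] x₀) ∧
      (gmMove k ℓ)^[j] x₀ w - (gmMove k ℓ)^[j] x₀ z ≤ ℓ := by
    obtain ⟨a, ha1, ha2⟩ := phaseA hk hkn hℓ x₀ hx
    obtain ⟨b, hb1, hb2⟩ := phaseB hk hkn hℓ z hz _ ha1 ha2
    obtain ⟨c, hc⟩ := phaseC hkn hℓ z w hz _ hb1 hb2
    refine ⟨c + (b + a), ?_⟩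
    rw [Function.iterate_add_apply, Function.iterate_add_apply]
    exact hc
  classical
  refine ⟨Nat.find hex, fun j => ⟨fun h => Nat.find_min' hex h, fun h => ?_⟩⟩
  induction j, h using Nat.le_induction with
  | base => exact Nat.find_spec hex
  | succ j _ ih =>
    rw [Function.iterate_succ_apply']
    exact ⟨big_step ih.1, regime_step hℓ z w ih.1 ih.2⟩
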